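/- Let X be a d-mode tensor in ℝ^{I₁×⋯×I_d}, let r = (r₁,…,r_d) be a target rank, let X̂ be the rank-r HOSVD approximation of X, and let X̂_opt be a best rank-r approximation of X. Then ‖X − X̂‖_F ≤ √d · ‖X − X̂_opt‖_F. -/

import Mathlib

open MeasureTheory ProbabilityTheory BigOperators Matrix

noncomputable section

/-- A `d`-mode tensor with dimensions `I 0 × ⋯ × I (d-1)`. -/
abbrev Tensor (d : ℕ) (I : Fin d → ℕ) : Type := (∀ j, Fin (I j)) → ℝ

namespace Tensor

variable {d : ℕ} {I J : Fin d → ℕ}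

/-- Square of the Frobenius norm of a tensor. -/
def frobSq (X : Tensor d I) : ℝ := ∑ i, (X i) ^ 2

/-- Frobenius norm of a tensor. -/
def frobNorm (X : Tensor d I) : ℝ := Real.sqrt (frobSq X)

/-- Mode-`j` product of a tensor with a square matrix `A ∈ ℝ^{I_j × I_j}`. -/
def modeMul (X : Tensor d I) (j : Fin d) (A : Matrix (Fin (I j)) (Fin (I j)) ℝ) :
    Tensor d I :=
  fun i => ∑ k, A (i j) k * X (Function.update i j k)

/-- `modeMulFirst X A t = X ×₁ A₁ ×₂ A₂ ⋯ ×ₜ Aₜ` (the first `t` modes, square matrices). -/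
def modeMulFirst (X : Tensor d I) (A : ∀ j, Matrix (Fin (I j)) (Fin (I j)) ℝ) : ℕ → Tensor d I
  | 0 => X
  | t + 1 =>
    if h : t < d then modeMul (modeMulFirst X A t) ⟨t, h⟩ (A ⟨t, h⟩)
    else modeMulFirst X A t

/-- Simultaneous mode product in every mode: `multiMul G A = G ×₁ A₁ ⋯ ×_d A_d`,
where `A j ∈ ℝ^{I_j × J_j}` and `G` has dimensions `J`. -/
def multiMul (G : Tensor d J) (A : ∀ j, Matrix (Fin (I j)) (Fin (J j)) ℝ) : Tensor d I :=
  fun i => ∑ k : ∀ j, Fin (J j), (∏ j, A j (i j) (k j)) * G k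

/-- Mode-`j` unfolding of a tensor, as a matrix with rows indexed by `Fin (I j)` and
columns indexed by the remaining modes. -/
def unfold (X : Tensor d I) (j : Fin d) :
    Matrix (Fin (I j)) (∀ k : {k : Fin d // k ≠ j}, Fin (I k.1)) ℝ :=
  Matrix.of fun a b => X fun k => if h : k = j then Fin.cast (congrArg I h.symm) a else b ⟨k, h⟩

end Tensor

/-- `singularValues A i` is the `(i+1)`-st largest singular value of `A`
(0-based indexing; `0` when `i` exceeds the number of rows). -/
def singularValues {m n : Type*} [Fintype m] [Fintype n] [DecidableEq m]
    (A : Matrix m n ℝ) : ℕ → ℝ := fun i =>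
  if h : i < Fintype.card m then
    let ev : Fin (Fintype.card m) → ℝ :=
      (Matrix.isHermitian_mul_conjTranspose_self A).eigenvalues ∘ (Fintype.equivFin m).symm
    Real.sqrt ((ev ∘ Tuple.sort ev) ⟨Fintype.card m - 1 - i, by omega⟩)
  else 0

/-- Spectral norm (largest singular value). -/
def specNorm {m n : Type*} [Fintype m] [Fintype n] [DecidableEq m]
    (A : Matrix m n ℝ) : ℝ := singularValues A 0

/-- Square of the Frobenius norm of a matrix. -/
def matFrobSq {m n : Type*} [Fintype m] [Fintype n] (M : Matrix m n ℝ) : ℝ :=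
  ∑ i, ∑ j, (M i j) ^ 2

/-- Frobenius norm of a matrix. -/
def matFrobNorm {m n : Type*} [Fintype m] [Fintype n] (M : Matrix m n ℝ) : ℝ :=
  Real.sqrt (matFrobSq M)

/-- A rectangular "diagonal" matrix with entries `s 0, s 1, …` placed along the diagonal
determined by the chosen enumerations of the index types. -/
def diagMat (m n : Type*) [Fintype m] [Fintype n] (s : ℕ → ℝ) : Matrix m n ℝ :=
  Matrix.of fun a b =>
    if (Fintype.equivFin m a : ℕ) = (Fintype.equivFin n b : ℕ) then s (Fintype.equivFin m a)
    else 0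

/-- `IsSVD M U s V` : `M = U Σ Vᵀ` is a singular value decomposition of `M`, with `U, V`
orthogonal and the singular values `s` nonnegative and arranged in decreasing order. -/
def IsSVD {m n : Type*} [Fintype m] [Fintype n] [DecidableEq m] [DecidableEq n]
    (M : Matrix m n ℝ) (U : Matrix m m ℝ) (s : ℕ → ℝ) (V : Matrix n n ℝ) : Prop :=
  Uᵀ * U = 1 ∧ Vᵀ * V = 1 ∧ Antitone s ∧ (∀ i, 0 ≤ s i) ∧
    (∀ i, min (Fintype.card m) (Fintype.card n) ≤ i → s i = 0) ∧
    M = U * diagMat m n s * Vᵀ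

/-- `B` is the rank-`r` truncated SVD of `M`: it is obtained from an SVD of `M` by
retaining only the `r` largest singular values. -/
def IsSVDTruncation {m n : Type*} [Fintype m] [Fintype n] [DecidableEq m] [DecidableEq n]
    (M : Matrix m n ℝ) (r : ℕ) (B : Matrix m n ℝ) : Prop :=
  ∃ U s V, IsSVD M U s V ∧ B = U * diagMat m n (fun i => if i < r then s i else 0) * Vᵀ

/-- `A` consists of the first `r` left singular vectors of `M` (the columns of the
orthogonal factor `U` of an SVD of `M` corresponding to the `r` largest singular values). -/
def IsTopLeftSingVecs {m n : Type*} [Fintype m] [Fintype n] [DecidableEq m] [DecidableEq n]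
    (M : Matrix m n ℝ) (r : ℕ) (A : Matrix m (Fin r) ℝ) : Prop :=
  ∃ U s V, IsSVD M U s V ∧ ∃ h : r ≤ Fintype.card m,
    ∀ (a : m) (k : Fin r), A a k = U a ((Fintype.equivFin m).symm (Fin.castLE h k))

/-- Column space of a matrix. -/
def colSpace {m n : Type*} [Fintype n] (M : Matrix m n ℝ) : Submodule ℝ (m → ℝ) :=
  LinearMap.range M.mulVecLin

/-- `Xopt` is a best multilinear rank-`r` approximation of `X` in the Frobenius norm. -/
def IsBestRankApprox {d : ℕ} {I : Fin d → ℕ} (X : Tensor d I) (r : Fin d → ℕ)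
    (Xopt : Tensor d I) : Prop :=
  (∀ j, (Tensor.unfold Xopt j).rank ≤ r j) ∧
    ∀ Y : Tensor d I, (∀ j, (Tensor.unfold Y j).rank ≤ r j) →
      Tensor.frobNorm (X - Xopt) ≤ Tensor.frobNorm (X - Y)

/-- `P` is a selection operator: its columns are distinct columns of the identity matrix. -/
def IsSelection {a b : Type*} [DecidableEq a] (P : Matrix a b ℝ) : Prop :=
  ∃ f : b → a, Function.Injective f ∧ ∀ i k, P i k = if i = f k then 1 else 0

section STHOSVD

variable {d : ℕ}

/-- Dimensions of the partially truncated core tensor in the STHOSVD with processing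
order `[0, 1, …, d-1]`: after processing the first `t` modes, mode `k` has dimension
`r k` for `k < t` and `I k` otherwise. -/
def stDims (I r : Fin d → ℕ) (t : ℕ) : Fin d → ℕ := fun k => if (k : ℕ) < t then r k else I k

theorem stDims_lt {I r : Fin d → ℕ} {t : ℕ} {k : Fin d} (h : (k : ℕ) < t) :
    stDims I r t k = r k := if_pos h

theorem stDims_ge {I r : Fin d → ℕ} {t : ℕ} {k : Fin d} (h : ¬ (k : ℕ) < t) :
    stDims I r t k = I k := if_neg h

theorem stDims_self {I r : Fin d → ℕ} (j : Fin d) : stDims I r (j : ℕ) j = I j :=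
  stDims_ge (lt_irrefl _)

/-- The partially truncated core tensor `G^{(t)} = X ×₁ A₁ᵀ ⋯ ×ₜ Aₜᵀ` of the STHOSVD
(processing order `[0, …, d-1]`). -/
def stCore {I r : Fin d → ℕ} (X : Tensor d I)
    (A : ∀ j, Matrix (Fin (I j)) (Fin (r j)) ℝ) (t : ℕ) : Tensor d (stDims I r t) :=
  Tensor.multiMul X fun k =>
    if h : (k : ℕ) < t then
      Matrix.reindex (finCongr (stDims_lt h).symm) (Equiv.refl _) (A k)ᵀ
    else Matrix.reindex (finCongr (stDims_ge h).symm) (Equiv.refl _)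
      (1 : Matrix (Fin (I k)) (Fin (I k)) ℝ)

/-- The `t`-th partial approximation `X̂^{(t)} = G^{(t)} ×₁ A₁ ⋯ ×ₜ Aₜ` of the STHOSVD. -/
def stPartial {I r : Fin d → ℕ} (X : Tensor d I)
    (A : ∀ j, Matrix (Fin (I j)) (Fin (r j)) ℝ) (t : ℕ) : Tensor d I :=
  Tensor.multiMul (stCore X A t) fun k =>
    if h : (k : ℕ) < t then
      Matrix.reindex (Equiv.refl _) (finCongr (stDims_lt h).symm) (A k)
    else Matrix.reindex (Equiv.refl _) (finCongr (stDims_ge h).symm)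
      (1 : Matrix (Fin (I k)) (Fin (I k)) ℝ)

/-- Column index type for the mode-`j` unfolding of a tensor with dimensions `I`. -/
abbrev colIdx (I : Fin d → ℕ) (j : Fin d) : Type := ∀ k : {k : Fin d // k ≠ j}, Fin (I k.1)

end STHOSVD

/-- Measurable space structure on matrices (entrywise). -/
instance matrixMeasurableSpace (m n : Type*) : MeasurableSpace (Matrix m n ℝ) :=
  inferInstanceAs (MeasurableSpace (m → n → ℝ))

/-- The distribution of a standard Gaussian random matrix: independent `N(0,1)` entries. -/
def gaussMat (m n : Type*) [Fintype m] [Fintype n] : Measure (Matrix m n ℝ) :=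
  (Measure.pi fun _ : m => Measure.pi fun _ : n => gaussianReal 0 1 :
    Measure (m → n → ℝ))

end

noncomputable section

/-- The structure-preserving STHOSVD approximation `X̂ = G^{(d)} ×₁ A₁ ⋯ ×_d A_d`, where
the core `G^{(d)} = X ×₁ P₁ᵀ ⋯ ×_d P_dᵀ` is built from the selection operators `P j` and
the (not necessarily orthonormal) factor matrices are `A j`. -/
def spApprox {d : ℕ} {I L : Fin d → ℕ} (X : Tensor d I)
    (P : ∀ j, Matrix (Fin (I j)) (Fin (L j)) ℝ)
    (A : ∀ j, Matrix (Fin (I j)) (Fin (L j)) ℝ) : Tensor d I :=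
  Tensor.multiMul (stCore X P d) fun k =>
    Matrix.reindex (Equiv.refl _) (finCongr (stDims_lt k.isLt).symm) (A k)

end
namespace Tensor

variable {d : ℕ} {I J K : Fin d → ℕ}

theorem frobSq_eq_dotProduct (X : Tensor d I) : frobSq X = X ⬝ᵥ X := by
  simp [frobSq, dotProduct, sq]

theorem frobSq_nonneg (X : Tensor d I) : 0 ≤ frobSq X :=
  Finset.sum_nonneg fun _ _ => sq_nonneg _

theorem multiMul_sub (X Y : Tensor d J) (A : ∀ j, Matrix (Fin (I j)) (Fin (J j)) ℝ) :
    multiMul (X - Y) A = multiMul X A - multiMul Y A := by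
  ext i
  simp [multiMul, mul_sub]

theorem multiMul_multiMul (X : Tensor d K) (B : ∀ j, Matrix (Fin (J j)) (Fin (K j)) ℝ)
    (A : ∀ j, Matrix (Fin (I j)) (Fin (J j)) ℝ) :
    multiMul (multiMul X B) A = multiMul X fun j => A j * B j := by
  ext i
  simp only [multiMul, Matrix.mul_apply, Finset.prod_univ_sum, Fintype.piFinset_univ,
    Finset.mul_sum, Finset.sum_mul, Finset.prod_mul_distrib]
  rw [Finset.sum_comm]
  simp only [mul_assoc]

theorem multiMul_one (X : Tensor d I) :
    multiMul X (fun j => (1 : Matrix (Fin (I j)) (Fin (I j)) ℝ)) = X := by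
  ext i
  rw [multiMul, Finset.sum_eq_single i]
  · simp
  · intro k _ hk
    obtain ⟨j, hj⟩ := Function.ne_iff.mp hk
    have h0 : (1 : Matrix (Fin (I j)) (Fin (I j)) ℝ) (i j) (k j) = 0 := Matrix.one_apply_ne hj.symm
    rw [Finset.prod_eq_zero (Finset.mem_univ j) h0, zero_mul]
  · simp

theorem multiMul_dotProduct (X : Tensor d J) (Y : Tensor d I)
    (A : ∀ j, Matrix (Fin (I j)) (Fin (J j)) ℝ) :
    multiMul X A ⬝ᵥ Y = X ⬝ᵥ multiMul Y fun j => (A j)ᵀ := by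
  simp only [dotProduct, multiMul, Finset.sum_mul, Finset.mul_sum, Matrix.transpose_apply]
  rw [Finset.sum_comm]
  refine Finset.sum_congr rfl fun _ _ => Finset.sum_congr rfl fun _ _ => ?_
  ring

/-- Pythagoras for a simultaneous mode product with orthogonal projections. -/
theorem frobSq_eq_add_of_proj (P : ∀ j, Matrix (Fin (I j)) (Fin (I j)) ℝ)
    (hs : ∀ j, (P j)ᵀ = P j) (hp : ∀ j, P j * P j = P j) (X Y : Tensor d I) :
    frobSq (X - multiMul Y P) = frobSq (X - multiMul X P) + frobSq (multiMul (X - Y) P) := by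
  have key (Z W : Tensor d I) : multiMul Z P ⬝ᵥ multiMul W P = Z ⬝ᵥ multiMul W P := by
    rw [multiMul_dotProduct, multiMul_multiMul]
    simp only [hs, hp]
  have h1 := key (X - Y) X
  have h2 := key (X - Y) Y
  have h3 := key X X
  have h4 := key X Y
  simp only [frobSq_eq_dotProduct, multiMul_sub, sub_dotProduct, dotProduct_sub] at *
  have c := dotProduct_comm X (multiMul X P)
  have c' := dotProduct_comm X (multiMul Y P)
  have c'' := dotProduct_comm (multiMul X P) (multiMul Y P)
  linarith

theorem frobSq_multiMul_le_of_proj (P : ∀ j, Matrix (Fin (I j)) (Fin (I j)) ℝ)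
    (hs : ∀ j, (P j)ᵀ = P j) (hp : ∀ j, P j * P j = P j) (X : Tensor d I) :
    frobSq (multiMul X P) ≤ frobSq X := by
  have h := frobSq_eq_add_of_proj P hs hp X 0
  have h0 : multiMul (0 : Tensor d I) P = 0 := by ext; simp [multiMul]
  rw [h0, sub_zero] at h
  linarith [frobSq_nonneg (X - multiMul X P)]

theorem multiMul_update_one (X : Tensor d I) (a : Fin d) (P : Matrix (Fin (I a)) (Fin (I a)) ℝ) :
    multiMul X (Function.update (fun j => (1 : Matrix (Fin (I j)) (Fin (I j)) ℝ)) a P) =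
      modeMul X a P := by
  ext i
  symm
  refine Finset.sum_of_injOn (Function.update i a) (Function.update_injective i a).injOn
    (by simp) ?_ ?_
  · intro k _ hk
    obtain ⟨j, hja, hj⟩ : ∃ j, j ≠ a ∧ i j ≠ k j := by
      by_contra! h
      refine hk ⟨k a, by simp, ?_⟩
      ext1 j
      by_cases hja : j = a
      · subst hja; simp
      · simp [hja, h j hja]
    rw [Finset.prod_eq_zero (Finset.mem_univ j), zero_mul]
    rw [Function.update_of_ne hja, Matrix.one_apply_ne hj]
  · intro q _
    congr 1
    rw [Finset.prod_eq_single a]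
    · simp
    · intro j _ hj
      simp [hj]
    · simp

/-- The truncation error in all modes is at most the sum of the errors in each mode. -/
theorem frobSq_sub_multiMul_le_sum (P : ∀ j, Matrix (Fin (I j)) (Fin (I j)) ℝ)
    (hs : ∀ j, (P j)ᵀ = P j) (hp : ∀ j, P j * P j = P j) (X : Tensor d I) :
    frobSq (X - multiMul X P) ≤ ∑ j, frobSq (X - modeMul X j (P j)) := by
  suffices h : ∀ S : Finset (Fin d),
      frobSq (X - multiMul X fun j => if j ∈ S then P j else 1) ≤
        ∑ j ∈ S, frobSq (X - modeMul X j (P j)) by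
    simpa using h Finset.univ
  intro S
  induction S using Finset.induction_on with
  | empty => simp [multiMul_one, frobSq]
  | insert a S ha ih =>
    set E := Function.update (fun j => (1 : Matrix (Fin (I j)) (Fin (I j)) ℝ)) a (P a) with hE
    have hfac : (multiMul X fun j => if j ∈ insert a S then P j else 1) =
        multiMul (multiMul X fun j => if j ∈ S then P j else 1) E := by
      rw [multiMul_multiMul]
      congr 1
      ext1 j
      by_cases hj : j = a
      · subst hj; simp [hE, ha]
      · simp [hE, hj]
    have hEs : ∀ j, (E j)ᵀ = E j := by
      intro j
      by_cases hj : j = a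
      · subst hj; simp [hE, hs]
      · simp [hE, hj]
    have hEp : ∀ j, E j * E j = E j := by
      intro j
      by_cases hj : j = a
      · subst hj; simp [hE, hp]
      · simp [hE, hj]
    rw [hfac, Finset.sum_insert ha, frobSq_eq_add_of_proj E hEs hEp, hE, multiMul_update_one]
    gcongr
    exact (frobSq_multiMul_le_of_proj E hEs hEp _).trans ih

theorem unfold_apply (X : Tensor d I) (j : Fin d) (p : Fin (I j))
    (b : ∀ k : {k : Fin d // k ≠ j}, Fin (I k.1)) :
    unfold X j p b = X ((Equiv.piSplitAt j fun k => Fin (I k)).symm (p, b)) := by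
  simp only [unfold, Matrix.of_apply]
  congr 1
  ext1 k
  by_cases h : k = j
  · subst h; simp
  · simp [h]

theorem matFrobSq_unfold (X : Tensor d I) (j : Fin d) : matFrobSq (unfold X j) = frobSq X := by
  simp only [matFrobSq, unfold_apply, frobSq]
  rw [← Fintype.sum_prod_type'
    (f := fun p b => X ((Equiv.piSplitAt j fun k => Fin (I k)).symm (p, b)) ^ 2)]
  exact Equiv.sum_comp (Equiv.piSplitAt j fun k => Fin (I k)).symm fun i => X i ^ 2

theorem unfold_sub (X Y : Tensor d I) (j : Fin d) :
    unfold (X - Y) j = unfold X j - unfold Y j := rfl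

theorem unfold_modeMul (X : Tensor d I) (j : Fin d) (P : Matrix (Fin (I j)) (Fin (I j)) ℝ) :
    unfold (modeMul X j P) j = P * unfold X j := by
  ext p b
  rw [Matrix.mul_apply, unfold_apply, modeMul]
  refine Finset.sum_congr rfl fun q _ => ?_
  rw [unfold_apply]
  congr 2
  · simp
  · ext1 k
    by_cases h : k = j
    · subst h; simp
    · simp [h]

end Tensor

section EckartYoung

variable {m n : Type*} [Fintype m] [Fintype n]

theorem matFrobSq_eq_trace (N : Matrix m n ℝ) : matFrobSq N = (N * Nᵀ).trace := by
  simp [matFrobSq, Matrix.trace, Matrix.mul_apply, sq]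

theorem matFrobSq_nonneg (N : Matrix m n ℝ) : 0 ≤ matFrobSq N :=
  Finset.sum_nonneg fun _ _ => Finset.sum_nonneg fun _ _ => sq_nonneg _

theorem matFrobSq_sub_proj {Q : Matrix m m ℝ} (hs : Qᵀ = Q) (hp : Q * Q = Q)
    (N : Matrix m n ℝ) : matFrobSq (N - Q * N) = matFrobSq N - (Q * (N * Nᵀ)).trace := by
  have h1 : (N * (Nᵀ * Q)).trace = (Q * (N * Nᵀ)).trace := by
    rw [← Matrix.mul_assoc, Matrix.trace_mul_comm]
  have h2 : (Q * N * (Nᵀ * Q)).trace = (Q * (N * Nᵀ)).trace := by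
    rw [← Matrix.mul_assoc, Matrix.trace_mul_comm, Matrix.mul_assoc Q N, ← Matrix.mul_assoc, hp]
  rw [matFrobSq_eq_trace, matFrobSq_eq_trace, Matrix.transpose_sub, Matrix.transpose_mul, hs,
    Matrix.sub_mul, Matrix.mul_sub, Matrix.mul_sub, Matrix.trace_sub, Matrix.trace_sub,
    Matrix.trace_sub, h1, h2, Matrix.mul_assoc]
  ring

theorem matFrobSq_proj {Q : Matrix m m ℝ} (hs : Qᵀ = Q) (hp : Q * Q = Q)
    (N : Matrix m n ℝ) : matFrobSq (Q * N) = (Q * (N * Nᵀ)).trace := by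
  rw [matFrobSq_eq_trace, Matrix.transpose_mul, hs, ← Matrix.mul_assoc, Matrix.trace_mul_comm,
    Matrix.mul_assoc Q N, ← Matrix.mul_assoc, hp]

theorem matFrobSq_sub_proj_le {Q : Matrix m m ℝ} (hs : Qᵀ = Q) (hp : Q * Q = Q)
    (N : Matrix m n ℝ) : matFrobSq (N - Q * N) ≤ matFrobSq N := by
  rw [matFrobSq_sub_proj hs hp, ← matFrobSq_proj hs hp]
  linarith [matFrobSq_nonneg (Q * N)]

/-- The orthogonal projection onto the column space of `B`. -/
theorem exists_proj_colSpace [DecidableEq n] (B : Matrix m n ℝ) :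
    ∃ Q : Matrix m m ℝ, Qᵀ = Q ∧ Q * Q = Q ∧ Q.trace = B.rank ∧ Q * B = B := by
  let S : Submodule ℝ (EuclideanSpace ℝ m) :=
    (LinearMap.range B.mulVecLin).map (WithLp.linearEquiv 2 ℝ (m → ℝ)).symm.toLinearMap
  have hS : Module.finrank ℝ S = B.rank :=
    LinearEquiv.finrank_map_eq (WithLp.linearEquiv 2 ℝ (m → ℝ)).symm _
  let b := stdOrthonormalBasis ℝ S
  let C : Matrix m (Fin (Module.finrank ℝ S)) ℝ := Matrix.of fun a i => (b i : EuclideanSpace ℝ m) a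
  have hC : Cᵀ * C = 1 := by
    ext i j
    have h := orthonormal_iff_ite.mp b.orthonormal i j
    rw [Submodule.coe_inner, PiLp.inner_apply] at h
    rw [Matrix.mul_apply, Matrix.one_apply, ← h]
    refine Finset.sum_congr rfl fun a _ => ?_
    exact mul_comm _ _
  refine ⟨C * Cᵀ, by simp, ?_, ?_, ?_⟩
  · rw [Matrix.mul_assoc, ← Matrix.mul_assoc Cᵀ, hC, Matrix.one_mul]
  · rw [Matrix.trace_mul_comm, hC, Matrix.trace_one, Fintype.card_fin, hS]
  · ext a c
    have hv : WithLp.toLp 2 (B.col c) ∈ S :=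
      ⟨B.col c, ⟨Pi.single c 1, by simp⟩, rfl⟩
    have h := congrArg (fun v : S => (v : EuclideanSpace ℝ m) a) (b.sum_repr' ⟨_, hv⟩)
    simp only [Submodule.coe_inner, PiLp.inner_apply, Submodule.coe_sum, Submodule.coe_smul,
      WithLp.ofLp_sum, Finset.sum_apply, WithLp.ofLp_smul, Pi.smul_apply, smul_eq_mul] at h
    rw [Matrix.mul_assoc, Matrix.mul_apply]
    refine Eq.trans (Finset.sum_congr rfl fun i _ => ?_) h
    rw [Matrix.mul_apply, mul_comm]
    exact congrArg (· * C a i) (Finset.sum_congr rfl fun x _ => mul_comm (C x i) (B x c))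

theorem IsSVD.mul_transpose_self [DecidableEq m] [DecidableEq n] {M : Matrix m n ℝ} {U : Matrix m m ℝ} {s : ℕ → ℝ}
    {V : Matrix n n ℝ} (h : IsSVD M U s V) :
    M * Mᵀ = U * Matrix.diagonal (fun a => s (Fintype.equivFin m a) ^ 2) * Uᵀ := by
  obtain ⟨_, hV, _, _, hs, hM⟩ := h
  have hD : diagMat m n s * (diagMat m n s)ᵀ =
      Matrix.diagonal (fun a => s (Fintype.equivFin m a) ^ 2) := by
    ext a b
    rw [Matrix.mul_apply, Matrix.diagonal_apply]
    simp only [Matrix.transpose_apply, diagMat, Matrix.of_apply]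
    split_ifs with hab
    · subst hab
      by_cases hc : (Fintype.equivFin m a : ℕ) < Fintype.card n
      · rw [Finset.sum_eq_single ((Fintype.equivFin n).symm ⟨_, hc⟩)]
        · simp [sq]
        · intro c _ hne
          rw [if_neg, zero_mul]
          intro h
          exact hne (by rw [Equiv.eq_symm_apply]; exact Fin.ext h.symm)
        · simp
      · simp [hs (Fintype.equivFin m a) ((min_le_right _ _).trans (not_lt.mp hc))]
    · refine Finset.sum_eq_zero fun c _ => ?_
      by_cases h1 : (Fintype.equivFin m a : ℕ) = Fintype.equivFin n c
      · rw [if_neg (c := (Fintype.equivFin m b : ℕ) = Fintype.equivFin n c), mul_zero]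
        intro h2
        exact hab ((Fintype.equivFin m).injective (Fin.ext (h1.trans h2.symm)))
      · rw [if_neg h1, zero_mul]
  rw [← hD, hM]
  simp only [Matrix.transpose_mul, Matrix.transpose_transpose, Matrix.mul_assoc]
  rw [← Matrix.mul_assoc Vᵀ V, hV, Matrix.one_mul]

theorem trace_mul_conj_diagonal [DecidableEq m] (Q U : Matrix m m ℝ) (v : m → ℝ) :
    (Q * (U * Matrix.diagonal v * Uᵀ)).trace = ∑ a, (Uᵀ * Q * U) a a * v a := by
  rw [← Matrix.mul_assoc, Matrix.trace_mul_comm, ← Matrix.mul_assoc, ← Matrix.mul_assoc]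
  simp [Matrix.trace]

theorem diag_mem_Icc_of_proj {W : Matrix m m ℝ} (hs : Wᵀ = W) (hp : W * W = W) (a : m) :
    0 ≤ W a a ∧ W a a ≤ 1 := by
  have h : W a a = ∑ b, W a b ^ 2 := by
    conv_lhs => rw [← hp, Matrix.mul_apply]
    refine Finset.sum_congr rfl fun b _ => ?_
    rw [sq, ← Matrix.transpose_apply W a b, hs]
  have h0 : 0 ≤ W a a := h ▸ Finset.sum_nonneg fun _ _ => sq_nonneg _
  have h1 : W a a ^ 2 ≤ W a a := by
    conv_rhs => rw [h]
    exact Finset.single_le_sum (f := fun b => W a b ^ 2) (fun _ _ => sq_nonneg _)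
      (Finset.mem_univ a)
  exact ⟨h0, by nlinarith⟩

/-- A weighted sum of decreasing nonnegative numbers, with weights in `[0, 1]` of total at most
`r`, is at most the sum of the `r` largest of them. -/
theorem sum_mul_le_sum_top {N r : ℕ} (e : m ≃ Fin N) (hr : r ≤ N) {f : ℕ → ℝ} (hf : Antitone f)
    (hf0 : ∀ i, 0 ≤ f i) {w : m → ℝ} (hw0 : ∀ a, 0 ≤ w a) (hw1 : ∀ a, w a ≤ 1)
    (hw : ∑ a, w a ≤ r) :
    ∑ a, w a * f (e a) ≤ ∑ a, (if (e a : ℕ) < r then 1 else 0) * f (e a) := by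
  have hcard : ∑ a, (if (e a : ℕ) < r then (1 : ℝ) else 0) = r := by
    rw [Equiv.sum_comp e fun i : Fin N => if (i : ℕ) < r then (1 : ℝ) else 0,
      Finset.sum_boole, Fin.card_filter_val_lt, min_eq_right hr]
  have hterm : ∑ a, w a * (f (e a) - f r) ≤
      ∑ a, (if (e a : ℕ) < r then 1 else 0) * (f (e a) - f r) := by
    refine Finset.sum_le_sum fun a _ => ?_
    split_ifs with h
    · exact mul_le_mul_of_nonneg_right (hw1 a) (sub_nonneg.mpr (hf h.le))
    · rw [zero_mul]
      exact mul_nonpos_of_nonneg_of_nonpos (hw0 a) (sub_nonpos.mpr (hf (not_lt.mp h)))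
  simp only [mul_sub, Finset.sum_sub_distrib, ← Finset.sum_mul, hcard] at hterm
  linarith [mul_le_mul_of_nonneg_right hw (hf0 r)]

theorem IsTopLeftSingVecs.transpose_mul_self [DecidableEq m] [DecidableEq n] {M : Matrix m n ℝ} {r : ℕ}
    {A : Matrix m (Fin r) ℝ} (h : IsTopLeftSingVecs M r A) : Aᵀ * A = 1 := by
  obtain ⟨U, s, V, ⟨hU, -⟩, hr, hA⟩ := h
  ext k l
  have h := congrFun (congrFun hU ((Fintype.equivFin m).symm (Fin.castLE hr k)))
    ((Fintype.equivFin m).symm (Fin.castLE hr l))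
  rw [Matrix.mul_apply, Matrix.one_apply] at h ⊢
  simpa [hA] using h

/-- Eckart–Young: projecting onto the first `r` left singular vectors is an optimal rank-`r`
approximation in the Frobenius norm. -/
theorem IsTopLeftSingVecs.matFrobSq_sub_le [DecidableEq m] [DecidableEq n] {M : Matrix m n ℝ} {r : ℕ}
    {A : Matrix m (Fin r) ℝ} (h : IsTopLeftSingVecs M r A) {B : Matrix m n ℝ} (hB : B.rank ≤ r) :
    matFrobSq (M - A * Aᵀ * M) ≤ matFrobSq (M - B) := by
  have hAA := h.transpose_mul_self
  obtain ⟨Q, hQs, hQp, hQt, hQB⟩ := exists_proj_colSpace B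
  have hPp : A * Aᵀ * (A * Aᵀ) = A * Aᵀ := by
    rw [Matrix.mul_assoc, ← Matrix.mul_assoc Aᵀ, hAA, Matrix.one_mul]
  have hQ : matFrobSq (M - Q * M) ≤ matFrobSq (M - B) := by
    have h := matFrobSq_sub_proj_le hQs hQp (M - B)
    rwa [Matrix.mul_sub, hQB, sub_sub_sub_cancel_right] at h
  refine le_trans ?_ hQ
  rw [matFrobSq_sub_proj (by simp) hPp, matFrobSq_sub_proj hQs hQp]
  obtain ⟨U, s, V, hsvd, hr, hA⟩ := h
  have hU := hsvd.1
  have hU' : U * Uᵀ = 1 := mul_eq_one_comm.mp hU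
  rw [hsvd.mul_transpose_self, trace_mul_conj_diagonal, trace_mul_conj_diagonal]
  have hUA : ∀ b k, (Uᵀ * A) b k = if Fintype.equivFin m b = Fin.castLE hr k then 1 else 0 := by
    intro b k
    have h := congrFun (congrFun hU b) ((Fintype.equivFin m).symm (Fin.castLE hr k))
    rw [Matrix.mul_apply, Matrix.one_apply] at h
    simp only [Equiv.eq_symm_apply] at h
    rw [← h, Matrix.mul_apply]
    simp only [hA]
  have hP : ∀ a, (Uᵀ * (A * Aᵀ) * U) a a =
      if (Fintype.equivFin m a : ℕ) < r then 1 else 0 := by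
    intro a
    have : Uᵀ * (A * Aᵀ) * U = (Uᵀ * A) * (Uᵀ * A)ᵀ := by
      simp [Matrix.mul_assoc]
    rw [this, Matrix.mul_apply]
    simp only [Matrix.transpose_apply, hUA]
    split_ifs with hlt
    · rw [Finset.sum_eq_single ⟨_, hlt⟩]
      · simp
      · intro k _ hk
        rw [if_neg, zero_mul]
        intro h
        exact hk (Fin.ext (by simp [h]))
      · simp
    · refine Finset.sum_eq_zero fun k _ => ?_
      rw [if_neg, zero_mul]
      intro h
      exact hlt (by simp [h])
  have hW : ∀ a, 0 ≤ (Uᵀ * Q * U) a a ∧ (Uᵀ * Q * U) a a ≤ 1 := by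
    refine diag_mem_Icc_of_proj ?_ ?_
    · simp [Matrix.mul_assoc, hQs]
    · calc Uᵀ * Q * U * (Uᵀ * Q * U) = Uᵀ * Q * (U * Uᵀ) * Q * U := by
            simp only [Matrix.mul_assoc]
        _ = Uᵀ * Q * U := by rw [hU', Matrix.mul_one, Matrix.mul_assoc Uᵀ, hQp]
  have htr : ∑ a, (Uᵀ * Q * U) a a ≤ r := by
    have : (Uᵀ * Q * U).trace = B.rank := by
      rw [Matrix.trace_mul_comm, ← Matrix.mul_assoc, hU', Matrix.one_mul, hQt]
    exact (this.trans_le (by exact_mod_cast hB))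
  have hanti : Antitone fun i => s i ^ 2 := fun i j hij =>
    pow_le_pow_left₀ (hsvd.2.2.2.1 j) (hsvd.2.2.1 hij) 2
  simp only [hP]
  exact sub_le_sub_left (sum_mul_le_sum_top (Fintype.equivFin m) hr hanti
    (fun i => sq_nonneg _) (fun a => (hW a).1) (fun a => (hW a).2) htr) _

end EckartYoung

/-- quasi-optimality of the HOSVD: the rank-`r` HOSVD approximation
`X̂` satisfies `‖X − X̂‖_F ≤ √d ‖X − X̂_opt‖_F`, where `X̂_opt` is a best multilinear
rank-`r` approximation of `X`. -/
theorem hosvd_quasi_optimal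
    (d : ℕ) (I r : Fin d → ℕ) (X : Tensor d I)
    (A : ∀ j, Matrix (Fin (I j)) (Fin (r j)) ℝ)
    (hA : ∀ j, IsTopLeftSingVecs (Tensor.unfold X j) (r j) (A j))
    (Xopt : Tensor d I) (hopt : IsBestRankApprox X r Xopt) :
    Tensor.frobNorm (X - Tensor.multiMul (Tensor.multiMul X fun j => (A j)ᵀ) A) ≤
      Real.sqrt d * Tensor.frobNorm (X - Xopt) := by
  have hmul : (Tensor.multiMul (Tensor.multiMul X fun j => (A j)ᵀ) A) =
      Tensor.multiMul X fun j => A j * (A j)ᵀ := Tensor.multiMul_multiMul _ _ _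
  have hp : ∀ j, A j * (A j)ᵀ * (A j * (A j)ᵀ) = A j * (A j)ᵀ := fun j => by
    rw [Matrix.mul_assoc, ← Matrix.mul_assoc (A j)ᵀ, (hA j).transpose_mul_self, Matrix.one_mul]
  have hmode : ∀ j, Tensor.frobSq (X - Tensor.modeMul X j (A j * (A j)ᵀ)) ≤
      Tensor.frobSq (X - Xopt) := fun j => by
    rw [← Tensor.matFrobSq_unfold _ j, ← Tensor.matFrobSq_unfold (X - Xopt) j,
      Tensor.unfold_sub, Tensor.unfold_sub, Tensor.unfold_modeMul]
    exact (hA j).matFrobSq_sub_le (hopt.1 j)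
  rw [hmul, Tensor.frobNorm, Tensor.frobNorm, ← Real.sqrt_mul (Nat.cast_nonneg d)]
  refine Real.sqrt_le_sqrt ?_
  refine (Tensor.frobSq_sub_multiMul_le_sum _ (fun j => by simp) hp X).trans ?_
  simpa using Finset.sum_le_sum fun j (_ : j ∈ Finset.univ) => hmode j
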